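/- Let p be a prime, n a positive integer, F the finite field of order p^n, and let G be the semidirect product of the additive group E of F by the multiplicative group C = F^× acting by field multiplication. Then G has a unique faithful irreducible character. -/

import Mathlib

open scoped Classical

noncomputable section

/-- `Qfield p` is the subfield of `ℂ` obtained by adjoining to `ℚ` all `p^a`-th
roots of unity for all positive integers `a` (any subfield of `ℂ` contains `ℚ`). -/
def Qfield (p : ℕ) : Subfield ℂ :=
  Subfield.closure {x : ℂ | ∃ a : ℕ, 0 < a ∧ x ^ p ^ a = 1}

/-- `χ : G → ℂ` is an irreducible (ordinary, complex) character of `G` if it is the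
character of some simple finite-dimensional complex representation of `G`. -/
def IsIrreducibleCharacter (G : Type) [Group G] (χ : G → ℂ) : Prop :=
  ∃ V : FDRep ℂ G, CategoryTheory.Simple V ∧ χ = fun g => V.character g

namespace AffineSemidirect

variable {F : Type} [Field F] [Fintype F] {φ : Fˣ →* MulAut (Multiplicative F)}

/-- For an additive character `ψ` of `F`, the representation of `F⁺ ⋊ Fˣ` on functions `Fˣ → ℂ`
given by `((x, u) f) t = ψ (t x) f (t u)`; it is induced from `ψ`. -/
def inducedRep (hφ : ∀ (u : Fˣ) (x : F),
      φ u (Multiplicative.ofAdd x) = Multiplicative.ofAdd ((u : F) * x)) (ψ : AddChar F ℂ) :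
    Representation ℂ (Multiplicative F ⋊[φ] Fˣ) (Fˣ → ℂ) where
  toFun g :=
    { toFun := fun f t => ψ (t * g.left.toAdd) * f (t * g.right)
      map_add' := fun f₁ f₂ => by ext t; simp [mul_add]
      map_smul' := fun c f => by ext t; simp [mul_left_comm] }
  map_one' := by ext; simp
  map_mul' g h := by
    have hact : (φ g.right h.left).toAdd = g.right * h.left.toAdd :=
      congrArg Multiplicative.toAdd (hφ g.right h.left.toAdd)
    refine LinearMap.ext fun f => funext fun t => ?_
    simp [hact, mul_add, AddChar.map_add_eq_mul, mul_assoc]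

/-- The faithful irreducible character of `F⁺ ⋊ Fˣ`: its value at `1` is `|F| - 1`, its value at
the other elements of `F⁺` is `-1`, and it vanishes elsewhere. -/
def faithfulChar (g : Multiplicative F ⋊[φ] Fˣ) : ℂ :=
  if g.right = 1 then (if g.left = 1 then (Fintype.card F : ℂ) else 0) - 1 else 0

theorem trace_inducedRep (hφ : ∀ (u : Fˣ) (x : F),
      φ u (Multiplicative.ofAdd x) = Multiplicative.ofAdd ((u : F) * x)) {ψ : AddChar F ℂ}
    (hψ : ψ.IsPrimitive) (g : Multiplicative F ⋊[φ] Fˣ) :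
    LinearMap.trace ℂ (Fˣ → ℂ) (inducedRep hφ ψ g) = faithfulChar g := by
  have hcoeff (t : Fˣ) : inducedRep hφ ψ g (Pi.single t 1) t =
      if g.right = 1 then ψ (t * g.left.toAdd) else 0 := by
    simp [inducedRep, Pi.single_apply]
  rw [LinearMap.trace_eq_matrix_trace ℂ (Pi.basisFun ℂ Fˣ), Matrix.trace]
  simp only [Matrix.diag_apply, LinearMap.toMatrix_apply, Pi.basisFun_apply, Pi.basisFun_repr,
    hcoeff, faithfulChar]
  split_ifs with hu hx
  · simp [hx, Fintype.card_units, Nat.cast_sub Fintype.card_pos]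
  · have h := AddChar.sum_mulShift g.left.toAdd hψ
    rw [if_neg (by simpa using hx), Fintype.sum_eq_add_sum_subtype_ne _ (0 : F),
      ← unitsEquivNeZero.sum_comp] at h
    simp at h
    linear_combination h
  · simp

theorem faithfulChar_inv (g : Multiplicative F ⋊[φ] Fˣ) :
    faithfulChar g⁻¹ = faithfulChar g := by
  by_cases hu : g.right = 1 <;> simp [faithfulChar, hu]

theorem eq_one_of_faithfulChar_eq {g : Multiplicative F ⋊[φ] Fˣ}
    (hg : faithfulChar g = faithfulChar (1 : Multiplicative F ⋊[φ] Fˣ)) : g = 1 := by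
  have hcard : (Fintype.card F : ℂ) ≠ 0 := Nat.cast_ne_zero.2 Fintype.card_ne_zero
  have hcard' : (1 : ℂ) ≠ Fintype.card F := by
    exact_mod_cast (Fintype.one_lt_card (α := F)).ne
  simp only [faithfulChar, SemidirectProduct.one_left, SemidirectProduct.one_right,
    if_true] at hg
  split_ifs at hg with hu hx
  · exact SemidirectProduct.ext hx hu
  · exact absurd (by linear_combination -hg) hcard
  · exact absurd (by linear_combination hg) hcard'

/-- The pairing of a class function with the faithful irreducible character. -/
theorem sum_mul_faithfulChar_inv [Fintype (Multiplicative F ⋊[φ] Fˣ)]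
    (hφ : ∀ (u : Fˣ) (x : F),
      φ u (Multiplicative.ofAdd x) = Multiplicative.ofAdd ((u : F) * x))
    {f : (Multiplicative F ⋊[φ] Fˣ) → ℂ} (hf : ∀ g h, f (h * g * h⁻¹) = f g) :
    ∑ g, f g * faithfulChar g⁻¹ = ((Fintype.card F : ℂ) - 1) *
      (f 1 - f (SemidirectProduct.inl (Multiplicative.ofAdd 1))) := by
  have hconj (u : Fˣ) : f (SemidirectProduct.inl (Multiplicative.ofAdd (u : F))) =
      f (SemidirectProduct.inl (Multiplicative.ofAdd 1)) := by
    rw [← hf (SemidirectProduct.inl (Multiplicative.ofAdd 1)) (SemidirectProduct.inr u),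
      ← map_inv, ← SemidirectProduct.inl_aut, hφ, mul_one]
  have hsum : ∑ x : F, f (SemidirectProduct.inl (Multiplicative.ofAdd x)) =
      f 1 + ((Fintype.card F : ℂ) - 1) *
        f (SemidirectProduct.inl (Multiplicative.ofAdd 1)) := by
    rw [Fintype.sum_eq_add_sum_subtype_ne _ (0 : F), ← unitsEquivNeZero.sum_comp]
    simp [hconj, Fintype.card_units, Nat.cast_sub Fintype.card_pos]
  calc ∑ g, f g * faithfulChar g⁻¹
      = ∑ x : Multiplicative F, ∑ u : Fˣ, f ⟨x, u⟩ *
          faithfulChar (⟨x, u⟩ : Multiplicative F ⋊[φ] Fˣ) := by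
        simp only [faithfulChar_inv]
        rw [← SemidirectProduct.equivProd.symm.sum_comp, Fintype.sum_prod_type]
        rfl
    _ = ∑ x : Multiplicative F, f (SemidirectProduct.inl x) *
          ((if x = 1 then (Fintype.card F : ℂ) else 0) - 1) := by
        simp [faithfulChar]
    _ = Fintype.card F * f 1 - ∑ x : F, f (SemidirectProduct.inl (Multiplicative.ofAdd x)) := by
        simp only [mul_sub, mul_one, Finset.sum_sub_distrib, mul_ite, mul_zero,
          Finset.sum_ite_eq', Finset.mem_univ, if_true, map_one, mul_comm (f 1)]
        rw [← Multiplicative.ofAdd.sum_comp]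
    _ = _ := by rw [hsum]; ring

theorem card_eq : Nat.card (Multiplicative F ⋊[φ] Fˣ) =
    Fintype.card F * (Fintype.card F - 1) := by
  rw [SemidirectProduct.card, Nat.card_eq_fintype_card, Nat.card_eq_fintype_card,
    Fintype.card_units, Fintype.card_multiplicative]

end AffineSemidirect

/-- Let `p` be a prime, `n` a positive integer, `F` the finite field with `p ^ n`
elements, and `G = F⁺ ⋊ Fˣ` the semidirect product of the additive group of `F`
(written multiplicatively) by the multiplicative group `Fˣ` acting by field
multiplication.  Then `G` has a unique faithful irreducible character. -/
theorem existsUnique_faithful_irr_char (p n : ℕ) (hp : p.Prime) (hn : 0 < n)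
    (F : Type) [Field F] [Fintype F] (hF : Fintype.card F = p ^ n)
    (φ : Fˣ →* MulAut (Multiplicative F))
    (hφ : ∀ (u : Fˣ) (x : F),
      φ u (Multiplicative.ofAdd x) = Multiplicative.ofAdd ((u : F) * x)) :
    ∃! χ : (Multiplicative F ⋊[φ] Fˣ) → ℂ,
      IsIrreducibleCharacter (Multiplicative F ⋊[φ] Fˣ) χ ∧
        ∀ g, χ g = χ 1 → g = 1 := by
  let G := Multiplicative F ⋊[φ] Fˣ
  have : Finite G := Finite.of_equiv _ SemidirectProduct.equivProd.symm
  let _ : Fintype G := Fintype.ofFinite G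
  let W : FDRep ℂ G :=
    FDRep.of (AffineSemidirect.inducedRep hφ (AddChar.FiniteField.primitiveChar_to_Complex F))
  have hW : W.character = AffineSemidirect.faithfulChar := funext fun g =>
    AffineSemidirect.trace_inducedRep hφ
      (AddChar.FiniteField.primitiveChar_to_Complex_isPrimitive F) g
  have hcard : 1 < Fintype.card F := Fintype.one_lt_card
  have hcard_sub : (Fintype.card F : ℂ) - 1 ≠ 0 :=
    sub_ne_zero.2 (by exact_mod_cast hcard.ne')
  have hsimple : CategoryTheory.Simple W := by
    rw [FDRep.simple_iff_char_is_norm_one]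
    have h := AffineSemidirect.sum_mul_faithfulChar_inv hφ W.char_conj
    rw [hW] at h ⊢
    rw [h, AffineSemidirect.card_eq]
    simp [AffineSemidirect.faithfulChar, Nat.cast_sub hcard.le, mul_comm]
  refine ⟨W.character, ⟨⟨W, hsimple, rfl⟩, fun g hg => ?_⟩, ?_⟩
  · rw [hW] at hg
    exact AffineSemidirect.eq_one_of_faithfulChar_eq hg
  · rintro _ ⟨⟨V, hV, rfl⟩, hfaithful⟩
    by_cases hiso : Nonempty (V ≅ W)
    · exact FDRep.char_iso hiso.some
    · have hG : (Nat.card G : ℂ) ≠ 0 := Nat.cast_ne_zero.2 Nat.card_pos.ne'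
      let _ : Invertible (Nat.card G : ℂ) := invertibleOfNonzero hG
      have horth := FDRep.char_orthonormal V W
      rw [if_neg hiso, hW, AffineSemidirect.sum_mul_faithfulChar_inv hφ V.char_conj,
        mul_eq_zero, mul_eq_zero, sub_eq_zero (a := V.character 1)] at horth
      have heq := (horth.resolve_left (inv_ne_zero hG)).resolve_left hcard_sub
      have h_inl := hfaithful _ heq.symm
      exact absurd (congrArg (fun g => g.left.toAdd) h_inl) one_ne_zero
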